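/- arXiv:1409.3323 — 2 statements merged into one kernel-verified Lean document; each statement's English description precedes it below -/
import Mathlib

section
/- For every n, M ≥ 1, every type promise T ⊆ [M]^n, and every partial function f : T → Bool, the certificate complexity satisfies C(f) ≤ 3 · bs(f)², i.e., the block sensitivity satisfies bs(f) ≥ √(C(f)/3). -/
open scoped Classical

namespace QCPaper

/-- A partial assignment `c` is consistent with the input `x` if it agrees with `x`
wherever it is defined. -/
def Consistent {n M : ℕ} (c : Fin n → Option (Fin M)) (x : Fin n → Fin M) : Prop :=
  ∀ i : Fin n, ∀ a : Fin M, c i = some a → x i = a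

/-- The size of a partial assignment: the number of indices where it is defined. -/
def paSize {n M : ℕ} (c : Fin n → Option (Fin M)) : ℕ :=
  (Finset.univ.filter fun i => c i ≠ none).card

/-- `c` is a certificate for the partial function `f` with promise `X`:
all inputs in `X` consistent with `c` get the same value under `f`. -/
def IsCertificate {n M : ℕ} (X : Set (Fin n → Fin M)) (f : (Fin n → Fin M) → Bool)
    (c : Fin n → Option (Fin M)) : Prop :=
  ∀ x ∈ X, ∀ y ∈ X, Consistent c x → Consistent c y → f x = f y

/-- The certificate complexity of `f` at the input `x`:
the least size of a certificate for `f` consistent with `x`. -/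
noncomputable def Cx {n M : ℕ} (X : Set (Fin n → Fin M)) (f : (Fin n → Fin M) → Bool)
    (x : Fin n → Fin M) : ℕ :=
  sInf {k | ∃ c : Fin n → Option (Fin M),
    IsCertificate X f c ∧ Consistent c x ∧ paSize c = k}

/-- The certificate complexity `C(f)`: the maximum of `Cx` over inputs in the promise. -/
noncomputable def certC {n M : ℕ} (X : Set (Fin n → Fin M))
    (f : (Fin n → Fin M) → Bool) : ℕ :=
  sSup {k | ∃ x ∈ X, Cx X f x = k}

/-- `b` is a sensitive block of `x` for `f` (with promise `X`). -/
def SensBlock {n M : ℕ} (X : Set (Fin n → Fin M)) (f : (Fin n → Fin M) → Bool)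
    (x : Fin n → Fin M) (b : Finset (Fin n)) : Prop :=
  ∃ y ∈ X, f y ≠ f x ∧ ∀ i : Fin n, y i ≠ x i → i ∈ b

/-- The block sensitivity of `f` at `x`: the largest number of pairwise disjoint
sensitive blocks of `x`. -/
noncomputable def bsx {n M : ℕ} (X : Set (Fin n → Fin M)) (f : (Fin n → Fin M) → Bool)
    (x : Fin n → Fin M) : ℕ :=
  sSup {m | ∃ b : Fin m → Finset (Fin n),
    (∀ j, SensBlock X f x (b j)) ∧ ∀ j j', j ≠ j' → Disjoint (b j) (b j')}

/-- The block sensitivity `bs(f)`. -/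
noncomputable def bs {n M : ℕ} (X : Set (Fin n → Fin M))
    (f : (Fin n → Fin M) → Bool) : ℕ :=
  sSup {m | ∃ x ∈ X, bsx X f x = m}

/-- The sensitivity of `f` at `x`: the largest number of pairwise disjoint
sensitive blocks of `x`, each of size 2. -/
noncomputable def sx {n M : ℕ} (X : Set (Fin n → Fin M)) (f : (Fin n → Fin M) → Bool)
    (x : Fin n → Fin M) : ℕ :=
  sSup {m | ∃ b : Fin m → Finset (Fin n),
    (∀ j, SensBlock X f x (b j) ∧ (b j).card = 2) ∧ ∀ j j', j ≠ j' → Disjoint (b j) (b j')}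

/-- The sensitivity `s(f)`. -/
noncomputable def sens {n M : ℕ} (X : Set (Fin n → Fin M))
    (f : (Fin n → Fin M) → Bool) : ℕ :=
  sSup {m | ∃ x ∈ X, sx X f x = m}

/-- The type of an input: the multiset of its entries. -/
def typeOf {n M : ℕ} (x : Fin n → Fin M) : Multiset (Fin M) :=
  Finset.univ.val.map x

/-- The multiplicity of the alphabet element `a` in the input `x`. -/
def mult {n M : ℕ} (x : Fin n → Fin M) (a : Fin M) : ℕ :=
  (Finset.univ.filter fun i => x i = a).card

/-- A type promise: the (nonempty) set of all strings with one fixed type. -/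
def IsTypePromise {n M : ℕ} (T : Set (Fin n → Fin M)) : Prop :=
  ∃ x₀ : Fin n → Fin M, T = {x | typeOf x = typeOf x₀}

/-- Decision trees over `[M]^n`: either a leaf with a Boolean answer, or a query
to an index together with a subtree for each possible answer. -/
inductive DTree (n M : ℕ) : Type
  | leaf : Bool → DTree n M
  | node : Fin n → (Fin M → DTree n M) → DTree n M

/-- Evaluation of a decision tree on an input. -/
def DTree.eval {n M : ℕ} : DTree n M → (Fin n → Fin M) → Bool
  | .leaf b, _ => b
  | .node i ts, x => (ts (x i)).eval x

/-- The cost of a decision tree on an input: the number of queries made. -/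
def DTree.cost {n M : ℕ} : DTree n M → (Fin n → Fin M) → ℕ
  | .leaf _, _ => 0
  | .node i ts, x => (ts (x i)).cost x + 1

/-- The depth of a decision tree: its maximum cost over all inputs. -/
def DTree.depth {n M : ℕ} : DTree n M → ℕ
  | .leaf _ => 0
  | .node _ ts => (Finset.univ.sup fun a => (ts a).depth) + 1

/-- The tree `t` computes `f` on the promise `X`. -/
def Computes {n M : ℕ} (X : Set (Fin n → Fin M)) (f : (Fin n → Fin M) → Bool)
    (t : DTree n M) : Prop :=
  ∀ x ∈ X, t.eval x = f x

/-- The deterministic query complexity `D(f)`: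
the least depth of a decision tree computing `f`. -/
noncomputable def detD {n M : ℕ} (X : Set (Fin n → Fin M))
    (f : (Fin n → Fin M) → Bool) : ℕ :=
  sInf {d | ∃ t : DTree n M, Computes X f t ∧ t.depth = d}

/-- A finitely supported probability distribution over decision trees,
given as a finite list of trees with probabilities. -/
structure RandAlg (n M : ℕ) where
  N : ℕ
  tree : Fin N → DTree n M
  prob : Fin N → ℝ
  nonneg : ∀ j, 0 ≤ prob j
  sum_one : ∑ j, prob j = 1

/-- The expected cost of a randomized algorithm on the input `x`. -/
noncomputable def expCost {n M : ℕ} (A : RandAlg n M) (x : Fin n → Fin M) : ℝ :=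
  ∑ j, A.prob j * ((A.tree j).cost x : ℝ)

/-- `A` is a zero-error randomized algorithm for `f`:
every tree in its support computes `f`. -/
def ZeroError {n M : ℕ} (X : Set (Fin n → Fin M)) (f : (Fin n → Fin M) → Bool)
    (A : RandAlg n M) : Prop :=
  ∀ j, A.prob j ≠ 0 → Computes X f (A.tree j)

/-- The cost of a randomized algorithm: the maximum over inputs in the promise of
the expected cost. -/
noncomputable def algCost {n M : ℕ} (X : Set (Fin n → Fin M)) (A : RandAlg n M) : ℝ :=
  sSup {r | ∃ x ∈ X, r = expCost A x}

/-- The zero-error randomized query complexity `R₀(f)`: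
the infimum cost of a zero-error randomized algorithm for `f`. -/
noncomputable def R0 {n M : ℕ} (X : Set (Fin n → Fin M))
    (f : (Fin n → Fin M) → Bool) : ℝ :=
  sInf {r | ∃ A : RandAlg n M, ZeroError X f A ∧ algCost X A = r}

/-- `A` is a bounded-error randomized algorithm for `f`: on every input in the promise,
it returns the correct answer with probability at least 2/3. -/
def BoundedError {n M : ℕ} (X : Set (Fin n → Fin M)) (f : (Fin n → Fin M) → Bool)
    (A : RandAlg n M) : Prop :=
  ∀ x ∈ X, (2/3 : ℝ) ≤ ∑ j ∈ Finset.univ.filter fun j => (A.tree j).eval x = f x, A.prob j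

/-- The depth of a randomized algorithm: the maximum depth of a tree in its support. -/
noncomputable def suppDepth {n M : ℕ} (A : RandAlg n M) : ℕ :=
  (Finset.univ.filter fun j => A.prob j ≠ 0).sup fun j => (A.tree j).depth

/-- The bounded-error randomized query complexity `R(f)`:
the least depth of a bounded-error randomized algorithm for `f`. -/
noncomputable def randR {n M : ℕ} (X : Set (Fin n → Fin M))
    (f : (Fin n → Fin M) → Bool) : ℕ :=
  sInf {d | ∃ A : RandAlg n M, BoundedError X f A ∧ suppDepth A = d}

/-- A set of inputs is symmetric if it is invariant under permuting coordinates. -/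
def SymmetricSet {n M : ℕ} (X : Set (Fin n → Fin M)) : Prop :=
  ∀ x ∈ X, ∀ σ : Equiv.Perm (Fin n), (x ∘ σ) ∈ X

/-- A function is symmetric if its value depends only on the type of the input. -/
def SymmetricFun {n M : ℕ} (X : Set (Fin n → Fin M))
    (f : (Fin n → Fin M) → Bool) : Prop :=
  ∀ x ∈ X, ∀ y ∈ X, typeOf x = typeOf y → f x = f y

/-- The measure `d(f)` for a non-constant symmetric function: the least distance between
the types of two inputs in the promise with different values under `f`. -/
noncomputable def dgap {n M : ℕ} (X : Set (Fin n → Fin M))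
    (f : (Fin n → Fin M) → Bool) : ℕ :=
  sInf {d | ∃ x ∈ X, ∃ y ∈ X, f x ≠ f y ∧
    (Finset.univ.sup fun a => Nat.dist (mult x a) (mult y a)) = d}

variable {n M : ℕ} {T : Set (Fin n → Fin M)} {f : (Fin n → Fin M) → Bool}
  {x y : Fin n → Fin M} {b : Finset (Fin n)}

theorem SensBlock.nonempty (h : SensBlock T f x b) : b.Nonempty := by
  obtain ⟨y, -, hne, hy⟩ := h
  by_contra hb
  rw [Finset.not_nonempty_iff_eq_empty] at hb
  refine hne (congrArg f (funext fun i => ?_))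
  by_contra hi
  simpa [hb] using hy i hi

theorem card_le_of_disjoint_sensBlocks {m : ℕ} {b : Fin m → Finset (Fin n)}
    (hb : ∀ j, SensBlock T f x (b j)) (hd : ∀ j j', j ≠ j' → Disjoint (b j) (b j')) :
    m ≤ n := by
  choose g hg using fun j => (hb j).nonempty
  have hinj : Function.Injective g := by
    intro j j' h
    by_contra hne
    exact Finset.disjoint_left.1 (hd j j' hne) (hg j) (h ▸ hg j')
  simpa using Fintype.card_le_of_injective g hinj

theorem bsx_le : bsx T f x ≤ n := by
  refine csSup_le' ?_
  rintro m ⟨b, hb, hd⟩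
  exact card_le_of_disjoint_sensBlocks hb hd

theorem card_le_bs (hx : x ∈ T) {ι : Type*} (s : Finset ι) (b : ι → Finset (Fin n))
    (hb : ∀ j ∈ s, SensBlock T f x (b j))
    (hd : ∀ j ∈ s, ∀ j' ∈ s, j ≠ j' → Disjoint (b j) (b j')) : s.card ≤ bs T f := by
  have h₁ : s.card ≤ bsx T f x := by
    refine le_csSup ⟨n, ?_⟩ ⟨fun j => b (s.equivFin.symm j), ?_, ?_⟩
    · rintro m ⟨b, hb, hd⟩
      exact card_le_of_disjoint_sensBlocks hb hd
    · exact fun j => hb _ (s.equivFin.symm j).2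
    · intro j j' hne
      refine hd _ (s.equivFin.symm j).2 _ (s.equivFin.symm j').2 fun h => hne ?_
      exact s.equivFin.symm.injective (Subtype.ext h)
  refine h₁.trans (le_csSup ⟨n, ?_⟩ ⟨x, hx, rfl⟩)
  rintro m ⟨z, -, rfl⟩
  exact bsx_le

/-- A fixed-point-free permutation admits a set of at least one third of the points
that is disjoint from its image. -/
theorem exists_disjoint_map_perm {α : Type*} [Fintype α] (σ : Equiv.Perm α)
    (hσ : ∀ i, σ i ≠ i) :
    ∃ A : Finset α, (∀ i ∈ A, σ i ∉ A) ∧ Fintype.card α ≤ 3 * A.card := by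
  obtain ⟨A, hA⟩ := (Set.toFinite {A : Finset α | ∀ i ∈ A, σ i ∉ A}).exists_maximal
    ⟨∅, by simp⟩
  refine ⟨A, hA.prop, ?_⟩
  have hcover : (Finset.univ : Finset α) ⊆ A ∪ (A.image σ ∪ A.image σ.symm) := by
    intro u _
    by_contra hu
    simp only [Finset.mem_union, Finset.mem_image, not_or, not_exists, not_and] at hu
    obtain ⟨huA, hu₁, hu₂⟩ := hu
    have hins : insert u A ∈ {A : Finset α | ∀ i ∈ A, σ i ∉ A} := by
      intro i hi hi'
      rw [Finset.mem_insert] at hi hi'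
      rcases hi with rfl | hi <;> rcases hi' with h | h
      · exact hσ _ h
      · exact hu₂ _ h (by simp)
      · exact hu₁ _ hi h
      · exact hA.prop i hi h
    exact huA (hA.le_of_ge hins (Finset.subset_insert u A) (Finset.mem_insert_self u A))
  have h₁ := Finset.card_le_card hcover
  have h₂ := Finset.card_union_le A (A.image σ ∪ A.image σ.symm)
  have h₃ := Finset.card_union_le (A.image σ) (A.image σ.symm)
  have h₄ : (A.image σ).card ≤ A.card := Finset.card_image_le
  have h₅ : (A.image σ.symm).card ≤ A.card := Finset.card_image_le
  rw [Finset.card_univ] at h₁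
  omega

theorem typeOf_comp_perm (x : Fin n → Fin M) (σ : Equiv.Perm (Fin n)) :
    typeOf (x ∘ σ) = typeOf x := by
  rw [typeOf, ← Multiset.map_map, Multiset.map_univ_val_equiv, typeOf]

theorem exists_perm_of_map_univ_eq {α β : Type*} [Fintype α] {g h : α → β}
    (hgh : Finset.univ.val.map g = Finset.univ.val.map h) :
    ∃ σ : Equiv.Perm α, ∀ i, g i = h (σ i) := by
  have hcard (a : β) : Fintype.card {i // g i = a} = Fintype.card {i // h i = a} := by
    have := congrArg (Multiset.count a) hgh
    rw [Multiset.count_map, Multiset.count_map] at this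
    rw [Fintype.card_subtype, Fintype.card_subtype]
    simpa only [Finset.card_def, Finset.filter_val, eq_comm] using this
  exact ⟨Equiv.ofFiberEquiv fun a => Fintype.equivOfCardEq (hcard a),
    fun i => (Equiv.ofFiberEquiv_map _ i).symm⟩

/-- Two strings of the same type that agree off `b` differ by a permutation of `b`. -/
theorem exists_perm_of_typeOf_eq (hxy : typeOf x = typeOf y)
    (hb : ∀ i, y i ≠ x i → i ∈ b) :
    ∃ σ : Equiv.Perm b, ∀ i : b, y i = x (σ i) := by
  have hsplit (z : Fin n → Fin M) : typeOf z = b.val.map z + bᶜ.val.map z := by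
    rw [typeOf, ← Multiset.map_add, ← Finset.disjUnion_val b bᶜ disjoint_compl_right]
    simp
  have hcompl : bᶜ.val.map x = bᶜ.val.map y := by
    refine Multiset.map_congr rfl fun i hi => ?_
    by_contra h
    exact Finset.mem_compl.1 hi (hb i (Ne.symm h))
  have hmap : b.val.map y = b.val.map x := by
    rw [hsplit, hsplit, hcompl] at hxy
    exact (add_right_cancel hxy).symm
  have hattach (z : Fin n → Fin M) :
      (Finset.univ : Finset b).val.map (fun i : b => z i) = b.val.map z :=
    Multiset.attach_map_val' b.val z
  exact exists_perm_of_map_univ_eq (g := fun i : b => y i) (h := fun i : b => x i)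
    (by rw [hattach, hattach, hmap])

theorem card_le_of_minimal_sensBlock (hT : IsTypePromise T) (hx : x ∈ T)
    (hb : Minimal (SensBlock T f x) b) : b.card ≤ 3 * bs T f := by
  obtain ⟨y, hy, hne, hdiff⟩ := hb.prop
  obtain ⟨x₀, rfl⟩ := hT
  have not_sens {z : Fin n → Fin M} (hz : typeOf z = typeOf x₀) (j : Fin n) (hj : j ∈ b)
      (hzj : z j = x j) (hzb : ∀ i, z i ≠ x i → i ∈ b) : f z = f x := by
    by_contra hfz
    have hs : SensBlock {x | typeOf x = typeOf x₀} f x (b.erase j) :=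
      ⟨z, hz, hfz, fun i hi => Finset.mem_erase.2 ⟨fun h => hi (h ▸ hzj), hzb i hi⟩⟩
    exact Finset.notMem_erase j b (hb.le_of_le hs (Finset.erase_subset j b) hj)
  obtain ⟨σ, hσ⟩ := exists_perm_of_typeOf_eq (hx.trans hy.symm) hdiff
  have hfix (i : b) : σ i ≠ i := by
    intro h
    refine hne (not_sens hy i i.2 ?_ hdiff)
    rw [hσ i, h]
  obtain ⟨A, hA, hcard⟩ := exists_disjoint_map_perm σ hfix
  rw [Fintype.card_coe] at hcard
  refine hcard.trans (Nat.mul_le_mul_left 3 ?_)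
  refine card_le_bs hy A (fun i => {(i : Fin n), (σ i : Fin n)}) ?_ ?_
  · intro i _
    have hz : typeOf (y ∘ Equiv.swap (i : Fin n) (σ i)) = typeOf x₀ :=
      (typeOf_comp_perm y _).trans hy
    refine ⟨y ∘ Equiv.swap (i : Fin n) (σ i), hz, ?_, ?_⟩
    · rw [not_sens hz (σ i) (σ i).2 (by simp [hσ i])]
      · exact hne.symm
      · intro k hk
        by_cases hki : k = i
        · exact hki ▸ i.2
        by_cases hkσ : k = σ i
        · exact hkσ ▸ (σ i).2
        · rw [Function.comp_apply, Equiv.swap_apply_of_ne_of_ne hki hkσ] at hk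
          exact hdiff k hk
    · intro k hk
      by_contra hmem
      simp only [Finset.mem_insert, Finset.mem_singleton, not_or] at hmem
      exact hk (by rw [Function.comp_apply, Equiv.swap_apply_of_ne_of_ne hmem.1 hmem.2])
  · intro i hi j hj hij
    have h₁ : (i : Fin n) ≠ j := fun h => hij (Subtype.ext h)
    have h₂ : (i : Fin n) ≠ σ j := fun h => hA j hj (Subtype.ext h ▸ hi)
    have h₃ : (σ i : Fin n) ≠ j := fun h => hA i hi ((Subtype.ext h : σ i = j) ▸ hj)
    have h₄ : (σ i : Fin n) ≠ σ j := fun h => hij (σ.injective (Subtype.ext h))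
    simp [h₁.symm, h₂.symm, h₃.symm, h₄.symm]

theorem Cx_le_three_bs_sq (hT : IsTypePromise T) (hx : x ∈ T) :
    Cx T f x ≤ 3 * bs T f ^ 2 := by
  obtain ⟨F, hF⟩ := (Set.toFinite {F : Finset (Finset (Fin n)) |
    (∀ b ∈ F, Minimal (SensBlock T f x) b) ∧
      ∀ b ∈ F, ∀ b' ∈ F, b ≠ b' → Disjoint b b'}).exists_maximal ⟨∅, by simp⟩
  obtain ⟨hmin, hdisj⟩ := hF.prop
  set U := F.biUnion id
  have hval {y : Fin n → Fin M} (hy : y ∈ T) (hyU : ∀ i ∈ U, y i = x i) : f y = f x := by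
    by_contra hne
    have hD : SensBlock T f x (Finset.univ.filter fun i => y i ≠ x i) :=
      ⟨y, hy, hne, fun i hi => by simpa using hi⟩
    obtain ⟨b, hbD, hb⟩ := exists_minimal_le_of_wellFoundedLT (SensBlock T f x) _ hD
    have hbU {i : Fin n} (hi : i ∈ b) : i ∉ U :=
      fun hiU => (Finset.mem_filter.1 (hbD hi)).2 (hyU i hiU)
    have hbF (b' : Finset (Fin n)) (hb' : b' ∈ F) : Disjoint b b' :=
      Finset.disjoint_left.2 fun i hi hi' => hbU hi (Finset.mem_biUnion.2 ⟨b', hb', hi'⟩)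
    have hins : b ∈ F := by
      refine hF.le_of_ge (y := insert b F) ⟨?_, ?_⟩ (Finset.subset_insert b F)
        (Finset.mem_insert_self b F)
      · intro c hc
        rcases Finset.mem_insert.1 hc with rfl | hc
        exacts [hb, hmin c hc]
      · intro c hc c' hc' hcc
        rcases Finset.mem_insert.1 hc with h | h <;>
          rcases Finset.mem_insert.1 hc' with h' | h'
        · exact absurd (h.trans h'.symm) hcc
        · exact h ▸ hbF c' h'
        · exact h' ▸ (hbF c h).symm
        · exact hdisj c h c' h' hcc
    obtain ⟨i, hi⟩ := hb.prop.nonempty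
    exact hbU hi (Finset.mem_biUnion.2 ⟨b, hins, hi⟩)
  have hCx : Cx T f x ≤ U.card := by
    refine Nat.sInf_le ⟨fun i => if i ∈ U then some (x i) else none, ?_, ?_, ?_⟩
    · intro y hy z hz hcy hcz
      rw [hval hy fun i hi => hcy i _ (if_pos hi), hval hz fun i hi => hcz i _ (if_pos hi)]
    · intro i a h
      by_cases hi : i ∈ U <;> simp_all
    · simp [paSize]
  have hFcard : F.card ≤ bs T f := card_le_bs hx F id (fun b hb => (hmin b hb).prop) hdisj
  calc Cx T f x ≤ U.card := hCx
    _ ≤ F.card * (3 * bs T f) := Finset.card_biUnion_le_card_mul _ _ _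
        fun b hb => card_le_of_minimal_sensBlock hT hx (hmin b hb)
    _ ≤ bs T f * (3 * bs T f) := Nat.mul_le_mul_right _ hFcard
    _ = 3 * bs T f ^ 2 := by ring

/-- on a type promise, `C(f) ≤ 3 · bs(f)²`, i.e. `bs(f) ≥ √(C(f)/3)`. -/
theorem certC_le_three_bs_sq (n M : ℕ) (hn : 1 ≤ n) (hM : 1 ≤ M)
    (T : Set (Fin n → Fin M)) (hT : IsTypePromise T)
    (f : (Fin n → Fin M) → Bool) :
    certC T f ≤ 3 * bs T f ^ 2 ∧
      Real.sqrt ((certC T f : ℝ) / 3) ≤ (bs T f : ℝ) := by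
  have h : certC T f ≤ 3 * bs T f ^ 2 := by
    refine csSup_le' ?_
    rintro k ⟨x, hx, rfl⟩
    exact Cx_le_three_bs_sq hT hx
  refine ⟨h, Real.sqrt_le_iff.2 ⟨Nat.cast_nonneg _, ?_⟩⟩
  have h' : (certC T f : ℝ) ≤ 3 * (bs T f : ℝ) ^ 2 := by exact_mod_cast h
  linarith

end QCPaper
end

section
/- There exists a constant c > 0 such that for all n ≥ 1, with M = n and T ⊆ [n]^n the type promise of permutations (all strings in which each of the n alphabet elements occurs exactly once, i.e., all bijections Fin n → Fin n), every partial function f : T → Bool satisfies R_0(f) ≥ c · min(D(f)^{1/2}, n^{1/3}); consequently R_0(f) ≥ c · D(f)^{1/3}. -/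
open scoped Classical

namespace QCPaper

/-- The list of indices queried by a decision tree on an input, in order. -/
def DTree.path {n M : ℕ} : DTree n M → (Fin n → Fin M) → List (Fin n)
  | .leaf _, _ => []
  | .node i ts, x => i :: (ts (x i)).path x

theorem DTree.length_path {n M : ℕ} (t : DTree n M) (x : Fin n → Fin M) :
    (t.path x).length = t.cost x := by
  induction t with
  | leaf b => rfl
  | node i ts ih => simp [DTree.path, DTree.cost, ih]

theorem DTree.eval_congr {n M : ℕ} (t : DTree n M) {x y : Fin n → Fin M}
    (h : ∀ i ∈ t.path x, y i = x i) : t.eval y = t.eval x := by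
  induction t with
  | leaf b => rfl
  | node i ts ih =>
    simp only [DTree.path, List.mem_cons, forall_eq_or_imp] at h
    simp only [DTree.eval, h.1]
    exact ih _ h.2

/-- The `s`-th query depends only on the answers to the earlier ones. -/
theorem DTree.getElem?_path_congr {n M : ℕ} (t : DTree n M) {x y : Fin n → Fin M} (s : ℕ)
    (h : ∀ i ∈ (t.path x).take s, y i = x i) : (t.path y)[s]? = (t.path x)[s]? := by
  induction t generalizing s with
  | leaf b => rfl
  | node i ts ih =>
    cases s with
    | zero => simp [DTree.path]
    | succ s =>
      simp only [DTree.path, List.take_succ_cons, List.mem_cons, forall_eq_or_imp] at h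
      simp only [DTree.path, List.getElem?_cons_succ, h.1]
      exact ih _ s h.2

/-- Query all indices of `U`, then continue with a tree that may depend on the answers. -/
theorem exists_tree_of_query {n M : ℕ} (f : (Fin n → Fin M) → Bool) (d : ℕ)
    (U : Finset (Fin n)) (X : Set (Fin n → Fin M))
    (h : ∀ x ∈ X, ∃ t : DTree n M, t.depth ≤ d ∧ Computes {y ∈ X | ∀ i ∈ U, y i = x i} f t) :
    ∃ t : DTree n M, t.depth ≤ d + U.card ∧ Computes X f t := by
  induction U using Finset.induction_on generalizing X with
  | empty =>
    rcases X.eq_empty_or_nonempty with rfl | ⟨x, hx⟩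
    · exact ⟨.leaf true, by simp [DTree.depth], by simp [Computes]⟩
    · obtain ⟨t, ht, hc⟩ := h x hx
      exact ⟨t, by simpa using ht, fun y hy => hc y ⟨hy, by simp⟩⟩
  | insert i U hi ih =>
    have key : ∀ a : Fin M, ∃ t : DTree n M, t.depth ≤ d + U.card ∧
        Computes {y ∈ X | y i = a} f t := by
      refine fun a => ih _ fun x hx => ?_
      obtain ⟨t, ht, hc⟩ := h x hx.1
      refine ⟨t, ht, fun y hy => hc y ⟨hy.1.1, fun j hj => ?_⟩⟩
      rcases Finset.mem_insert.1 hj with rfl | hj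
      · rw [hy.1.2, hx.2]
      · exact hy.2 j hj
    choose ts hts hc using key
    refine ⟨.node i ts, ?_, fun y hy => hc (y i) y ⟨hy, rfl⟩⟩
    rw [Finset.card_insert_of_notMem hi, DTree.depth, ← add_assoc]
    exact Nat.succ_le_succ (Finset.sup_le fun a _ => hts a)

/-- The values of `z` on `U` determine `f` among permutations. -/
def Certifies {n : ℕ} (f : (Fin n → Fin n) → Bool) (z : Fin n → Fin n)
    (U : Finset (Fin n)) : Prop :=
  ∀ y, Function.Bijective y → (∀ i ∈ U, y i = z i) → f y = f z

theorem Computes.certifies {n : ℕ} {f : (Fin n → Fin n) → Bool} {t : DTree n n}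
    (ht : Computes {x : Fin n → Fin n | Function.Bijective x} f t) {z : Fin n → Fin n}
    (hz : Function.Bijective z) : Certifies f z (t.path z).toFinset := fun y hy h => by
  rw [← ht y hy, ← ht z hz]
  exact t.eval_congr fun i hi => h i (List.mem_toFinset.2 hi)

/-- Certificates for different values conflict at an index or at a value. -/
theorem Certifies.conflict {n : ℕ} {f : (Fin n → Fin n) → Bool} {y z : Fin n → Fin n}
    {U V : Finset (Fin n)} (hy : Function.Bijective y) (hz : Function.Bijective z)
    (hV : Certifies f y V) (hU : Certifies f z U) (hne : f y ≠ f z) :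
    (∃ i ∈ V, i ∈ U ∧ y i ≠ z i) ∨ ∃ i ∈ V, ∃ j ∈ U, i ≠ j ∧ y i = z j := by
  by_contra! hcon
  obtain ⟨h1, h2⟩ := hcon
  let g : Fin n → Fin n := fun i => if i ∈ U then z i else y i
  have hgU : ∀ i ∈ U, g i = z i := fun i hi => if_pos hi
  have hgV : ∀ i ∈ V, g i = y i := fun i hi => by
    by_cases hiU : i ∈ U
    · rw [hgU i hiU, h1 i hi hiU]
    · exact if_neg hiU
  have hinj : Set.InjOn g (U ∪ V : Finset (Fin n)) := by
    intro i hi j hj hij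
    by_contra hne'
    rcases Finset.mem_union.1 (Finset.mem_coe.1 hi) with hi | hi <;>
      rcases Finset.mem_union.1 (Finset.mem_coe.1 hj) with hj | hj
    · rw [hgU i hi, hgU j hj] at hij
      exact hne' (hz.1 hij)
    · rw [hgU i hi, hgV j hj] at hij
      exact h2 j hj i hi (Ne.symm hne') hij.symm
    · rw [hgV i hi, hgU j hj] at hij
      exact h2 i hi j hj hne' hij
    · rw [hgV i hi, hgV j hj] at hij
      exact hne' (hy.1 hij)
  obtain ⟨e, he⟩ := Finset.exists_equiv_extend_of_card_eq (t := (Finset.univ : Finset (Fin n)))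
    (by simp) (Finset.subset_univ _) hinj
  have hw : Function.Bijective fun i => (e i : Fin n) :=
    Finite.injective_iff_bijective.1 (Subtype.val_injective.comp e.injective)
  apply hne
  rw [← hV _ hw fun i hi => (he i (Finset.mem_union_right _ hi)).trans (hgV i hi),
    ← hU _ hw fun i hi => (he i (Finset.mem_union_left _ hi)).trans (hgU i hi)]

/-- If small certificates exist, and one can always find a permutation consistent with the known
entries whose small certificate uses only fresh values, then querying such certificates in
`4 * k + 1` rounds and taking the majority value computes `f`. The number `N b` counts the past
rounds with value `b`, `P` is the set of queried indices, and `A` the set of used values. -/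
theorem exists_tree_of_rounds {n : ℕ} (f : (Fin n → Fin n) → Bool) (k : ℕ)
    (hcert : ∀ y, Function.Bijective y → ∃ V : Finset (Fin n), V.card ≤ k ∧ Certifies f y V)
    (hstep : ∀ (P A : Finset (Fin n)) (σ : Fin n → Fin n), Function.Bijective σ →
      P.card ≤ 4 * k * k → A.card ≤ 4 * k * k →
      ∃ (z : Fin n → Fin n) (U : Finset (Fin n)), Function.Bijective z ∧ (∀ i ∈ P, z i = σ i) ∧
        U.card ≤ k ∧ Certifies f z U ∧ ∀ j ∈ U, j ∉ P → z j ∉ A)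
    (l : ℕ) (P A : Finset (Fin n)) (σ : Fin n → Fin n) (N : Bool → ℕ)
    (hσ : Function.Bijective σ) (hN : N true + N false + l = 4 * k + 1)
    (hP : P.card ≤ (N true + N false) * k) (hA : A.card ≤ (N true + N false) * k)
    (hinv : ∀ y, Function.Bijective y → (∀ i ∈ P, y i = σ i) → ∀ V : Finset (Fin n),
      Certifies f y V → N (!f y) ≤ (V ∩ P).card + (V.image y ∩ A).card) :
    ∃ t : DTree n n, t.depth ≤ l * k ∧
      Computes {y | Function.Bijective y ∧ ∀ i ∈ P, y i = σ i} f t := by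
  induction l generalizing P A σ N with
  | zero =>
    have hle : ∀ y, Function.Bijective y → (∀ i ∈ P, y i = σ i) → N (!f y) ≤ 2 * k := by
      intro y hy hyP
      obtain ⟨V, hVk, hV⟩ := hcert y hy
      have h1 := hinv y hy hyP V hV
      have h2 : (V ∩ P).card ≤ V.card := Finset.card_le_card Finset.inter_subset_left
      have h3 : (V.image y ∩ A).card ≤ V.card :=
        (Finset.card_le_card Finset.inter_subset_left).trans Finset.card_image_le
      omega
    refine ⟨.leaf (decide (2 * k < N true)), by simp [DTree.depth], ?_⟩
    rintro y ⟨hy, hyP⟩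
    have h := hle y hy hyP
    cases hfy : f y
    · simp only [hfy, Bool.not_false] at h
      simpa [DTree.eval] using h
    · simp only [hfy, Bool.not_true] at h
      simp only [DTree.eval, decide_eq_true_eq]
      omega
  | succ l ih =>
    have hle : (N true + N false) * k ≤ 4 * k * k := Nat.mul_le_mul_right k (by omega)
    obtain ⟨z, U, hz, hzP, hUk, hU, hfresh⟩ := hstep P A σ hσ (hP.trans hle) (hA.trans hle)
    suffices h : ∀ x ∈ {y | Function.Bijective y ∧ ∀ i ∈ P, y i = σ i},
        ∃ t : DTree n n, t.depth ≤ l * k ∧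
          Computes {y ∈ {y | Function.Bijective y ∧ ∀ i ∈ P, y i = σ i} |
            ∀ i ∈ U, y i = x i} f t by
      obtain ⟨t, ht, hc⟩ := exists_tree_of_query f (l * k) U _ h
      exact ⟨t, by rw [Nat.succ_mul]; omega, hc⟩
    rintro x ⟨hx, hxP⟩
    have hN' : Function.update N (f z) (N (f z) + 1) true +
        Function.update N (f z) (N (f z) + 1) false = N true + N false + 1 := by
      cases f z <;> simp [Function.update] <;> omega
    refine (ih (P ∪ U) (A ∪ (U \ P).image z) x
      (Function.update N (f z) (N (f z) + 1)) hx (by omega) ?_ ?_ ?_).imp fun t ht => ?_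
    rotate_right
    · refine ⟨ht.1, fun y hy => ht.2 y ⟨hy.1.1, fun i hi => ?_⟩⟩
      rcases Finset.mem_union.1 hi with hi | hi
      · rw [hy.1.2 i hi, hxP i hi]
      · exact hy.2 i hi
    · rw [hN', Nat.succ_mul]
      exact (Finset.card_union_le _ _).trans (add_le_add hP hUk)
    · rw [hN', Nat.succ_mul]
      exact (Finset.card_union_le _ _).trans (add_le_add hA
        (Finset.card_image_le.trans ((Finset.card_le_card Finset.sdiff_subset).trans hUk)))
    · intro y hy hyPU V hV
      have hyP : ∀ i ∈ P, y i = σ i := fun i hi => by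
        rw [hyPU i (Finset.mem_union_left _ hi), hxP i hi]
      have hold := hinv y hy hyP V hV
      have hs1 : V ∩ P ⊆ V ∩ (P ∪ U) :=
        Finset.inter_subset_inter_left Finset.subset_union_left
      have hs2 : V.image y ∩ A ⊆ V.image y ∩ (A ∪ (U \ P).image z) :=
        Finset.inter_subset_inter_left Finset.subset_union_left
      by_cases hfz : f y = f z
      · have hne : (!f y) ≠ f z := by rw [hfz]; cases f z <;> simp
        rw [Function.update_of_ne hne]
        exact hold.trans (add_le_add (Finset.card_le_card hs1) (Finset.card_le_card hs2))
      · have heq : (!f y) = f z := by revert hfz; cases f y <;> cases f z <;> simp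
        rw [heq] at hold ⊢
        rw [Function.update_self]
        rcases hV.conflict hy hz hU hfz with ⟨i, hiV, hiU, hne⟩ | ⟨i, hiV, j, hjU, hij, hyz⟩
        · have hiP : i ∉ P := fun hiP => hne (by rw [hyP i hiP, hzP i hiP])
          have hlt : (V ∩ P).card < (V ∩ (P ∪ U)).card :=
            Finset.card_lt_card ⟨hs1, fun hs => hiP (Finset.mem_inter.1 (hs
              (Finset.mem_inter.2 ⟨hiV, Finset.mem_union_right _ hiU⟩))).2⟩
          have := Finset.card_le_card hs2
          omega
        · have hjP : j ∉ P := fun hjP => hij (hy.1 (by rw [hyz, hyP j hjP, hzP j hjP]))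
          have hlt : (V.image y ∩ A).card < (V.image y ∩ (A ∪ (U \ P).image z)).card := by
            refine Finset.card_lt_card ⟨hs2, fun hs => hfresh j hjU hjP ?_⟩
            refine (Finset.mem_inter.1 (hs (Finset.mem_inter.2 ⟨?_, ?_⟩))).2
            · exact hyz ▸ Finset.mem_image_of_mem y hiV
            · exact Finset.mem_union_right _ (Finset.mem_image_of_mem z
                (Finset.mem_sdiff.2 ⟨hjU, hjP⟩))
          have := Finset.card_le_card hs1
          omega

/-- The permutations that agree with `σ` on `P`. -/
noncomputable def completions {n : ℕ} (P : Finset (Fin n)) (σ : Fin n → Fin n) :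
    Finset (Fin n → Fin n) :=
  Finset.univ.filter fun z => Function.Bijective z ∧ ∀ i ∈ P, z i = σ i

/-- The completions on which `t` makes at most `k` queries, one of which finds a value of `A`
outside `P`. -/
noncomputable def hits {n : ℕ} (P A : Finset (Fin n)) (σ : Fin n → Fin n) (k : ℕ)
    (t : DTree n n) : Finset (Fin n → Fin n) :=
  (completions P σ).filter fun z => t.cost z ≤ k ∧ ∃ j ∈ t.path z, j ∉ P ∧ z j ∈ A

theorem card_hits_mul_le {n : ℕ} (P A : Finset (Fin n)) (σ : Fin n → Fin n) (k : ℕ)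
    (t : DTree n n) :
    (hits P A σ k t).card * (n - P.card - k) ≤ (completions P σ).card * (A.card * k) := by
  rcases Nat.eq_zero_or_pos n with rfl | hn
  · simp
  have : NeZero n := ⟨hn.ne'⟩
  have hex : ∀ z : Fin n → Fin n, z ∈ hits P A σ k t →
      ∃ j, j ∈ t.path z ∧ j ∉ P ∧ z j ∈ A := fun z hz => (Finset.mem_filter.1 hz).2.2
  choose! j hjpath hjP hjA using hex
  let F : (Fin n → Fin n) → Finset (Fin n) := fun z => Finset.univ \ (P ∪ (t.path z).toFinset)
  have hF : ∀ z ∈ hits P A σ k t, n - P.card - k ≤ (F z).card := by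
    intro z hz
    have h1 : (t.path z).toFinset.card ≤ k := (List.toFinset_card_le _).trans
      ((t.length_path z).le.trans (Finset.mem_filter.1 hz).2.1)
    have h2 := Finset.card_union_le P (t.path z).toFinset
    rw [Finset.card_sdiff_of_subset (Finset.subset_univ _), Finset.card_univ, Fintype.card_fin]
    omega
  -- swapping the location of the hit with an unqueried index leaves the earlier queries unchanged
  have hpath : ∀ z ∈ hits P A σ k t, ∀ i ∈ F z,
      (t.path (z ∘ Equiv.swap (j z) i))[(t.path z).idxOf (j z)]? = some (j z) := by
    intro z hz i hi
    rw [t.getElem?_path_congr (x := z)]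
    · exact List.getElem?_idxOf (hjpath z hz)
    · intro q hq
      have hqj : q ≠ j z := by
        rintro rfl
        have := List.mem_take_iff_idxOf_lt (hjpath z hz) |>.1 hq
        omega
      have hqi : q ≠ i := by
        rintro rfl
        simp only [F, Finset.mem_sdiff, Finset.mem_union, List.mem_toFinset, not_or] at hi
        exact hi.2.2 (List.mem_of_mem_take hq)
      simp [Equiv.swap_apply_of_ne_of_ne hqj hqi]
  calc (hits P A σ k t).card * (n - P.card - k)
      ≤ ∑ z ∈ hits P A σ k t, (F z).card := by
        rw [← smul_eq_mul]
        exact Finset.card_nsmul_le_sum _ _ _ hF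
    _ = ((hits P A σ k t).sigma F).card := (Finset.card_sigma _ _).symm
    _ ≤ (completions P σ ×ˢ A ×ˢ Finset.range k).card := by
        refine Finset.card_le_card_of_injOn
          (fun q => (q.1 ∘ Equiv.swap (j q.1) q.2, q.1 (j q.1), (t.path q.1).idxOf (j q.1)))
          ?_ ?_
        · rintro ⟨z, i⟩ hq
          obtain ⟨hz, hi⟩ := Finset.mem_sigma.1 hq
          dsimp only at hz hi
          have hz' := Finset.mem_filter.1 hz
          have hzc := (Finset.mem_filter.1 hz'.1).2
          have hiP : i ∉ P := by
            simp only [F, Finset.mem_sdiff, Finset.mem_union, not_or] at hi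
            exact hi.2.1
          simp only [Finset.coe_product, Set.mem_prod, Finset.mem_coe, Finset.mem_range]
          refine ⟨Finset.mem_filter.2 ⟨Finset.mem_univ _,
            hzc.1.comp (Equiv.bijective _), fun q hq => ?_⟩, hjA z hz, ?_⟩
          · rw [Function.comp_apply, Equiv.swap_apply_of_ne_of_ne, hzc.2 q hq]
            · exact fun h => hjP z hz (h ▸ hq)
            · exact fun h => hiP (h ▸ hq)
          · have := List.idxOf_lt_length_of_mem (hjpath z hz)
            have := t.length_path z
            have := hz'.2.1
            omega
        · rintro ⟨z, i⟩ hq ⟨z', i'⟩ hq' heq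
          obtain ⟨hz, hi⟩ := Finset.mem_sigma.1 hq
          obtain ⟨hz', hi'⟩ := Finset.mem_sigma.1 hq'
          simp only [Prod.mk.injEq] at heq hi hi' hz hz'
          obtain ⟨h1, h2, h3⟩ := heq
          have hjj : j z = j z' := by
            have e1 := hpath z hz i hi
            have e2 := hpath z' hz' i' hi'
            rw [h1, h3, e2] at e1
            exact (Option.some.inj e1).symm
          have hbij : Function.Bijective z' :=
            (Finset.mem_filter.1 (Finset.mem_filter.1 hz').1).2.1
          have hii : i = i' := by
            have e := congrFun h1 i
            simp only [Function.comp_apply, Equiv.swap_apply_right] at e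
            rw [h2] at e
            have e' := hbij.1 e
            have := congrArg (Equiv.swap (j z') i') e'
            simpa using this.symm
          subst hii
          have hzz : z = z' := by
            funext q
            have e := congrFun h1 (Equiv.swap (j z) i q)
            simp only [Function.comp_apply, Equiv.swap_apply_self, ← hjj] at e
            exact e
          subst hzz
          rfl
    _ = (completions P σ).card * (A.card * k) := by
        rw [Finset.card_product, Finset.card_product, Finset.card_range]

theorem expCost_le_algCost {n M : ℕ} {X : Set (Fin n → Fin M)} (B : RandAlg n M)
    {x : Fin n → Fin M} (hx : x ∈ X) : expCost B x ≤ algCost X B := by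
  refine le_csSup (Set.Finite.bddAbove ?_) ⟨x, hx, rfl⟩
  refine (Set.finite_range (expCost B)).subset ?_
  rintro _ ⟨y, -, rfl⟩
  exact ⟨y, rfl⟩

theorem expCost_nonneg {n M : ℕ} (B : RandAlg n M) (x : Fin n → Fin M) : 0 ≤ expCost B x :=
  Finset.sum_nonneg fun j _ => mul_nonneg (B.nonneg j) (Nat.cast_nonneg _)

/-- If every tree in the support has total cost at least `c` on `G`, so does the algorithm. -/
theorem le_sum_expCost {n M : ℕ} (B : RandAlg n M) (G : Finset (Fin n → Fin M)) (c : ℝ)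
    (h : ∀ j, B.prob j ≠ 0 → c ≤ ∑ z ∈ G, ((B.tree j).cost z : ℝ)) :
    c ≤ ∑ z ∈ G, expCost B z := by
  calc c = ∑ j, B.prob j * c := by rw [← Finset.sum_mul, B.sum_one, one_mul]
    _ ≤ ∑ j, B.prob j * ∑ z ∈ G, ((B.tree j).cost z : ℝ) := by
        refine Finset.sum_le_sum fun j _ => ?_
        by_cases hj : B.prob j = 0
        · simp [hj]
        · exact mul_le_mul_of_nonneg_left (h j hj) (B.nonneg j)
    _ = ∑ z ∈ G, expCost B z := by
        simp only [expCost, Finset.mul_sum]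
        exact Finset.sum_comm

theorem exists_certificate {n : ℕ} {f : (Fin n → Fin n) → Bool} (B : RandAlg n n)
    (hB : ZeroError {x : Fin n → Fin n | Function.Bijective x} f B) {k : ℕ}
    {y : Fin n → Fin n} (hy : Function.Bijective y) (hk : expCost B y < k + 1) :
    ∃ V : Finset (Fin n), V.card ≤ k ∧ Certifies f y V := by
  by_contra! hcon
  refine hk.not_ge ?_
  have := le_sum_expCost B {y} (k + 1) fun j hj => ?_
  · simpa using this
  rw [Finset.sum_singleton]
  by_contra! hlt
  refine hcon _ ?_ ((hB j hj).certifies hy)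
  rw [← Nat.cast_add_one, Nat.cast_lt, Nat.lt_succ_iff, ← DTree.length_path] at hlt
  exact (List.toFinset_card_le _).trans hlt

theorem exists_fresh_certificate {n : ℕ} {f : (Fin n → Fin n) → Bool} (B : RandAlg n n)
    (hB : ZeroError {x : Fin n → Fin n | Function.Bijective x} f B) {k : ℕ} {r : ℝ}
    (hr : ∀ y, Function.Bijective y → expCost B y ≤ r) (hk : 2 * r < k + 1)
    (P A : Finset (Fin n)) {σ : Fin n → Fin n} (hσ : Function.Bijective σ)
    (hpos : 0 < n - P.card - k) (hlarge : 2 * (A.card * k) ≤ n - P.card - k) :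
    ∃ (z : Fin n → Fin n) (U : Finset (Fin n)), Function.Bijective z ∧ (∀ i ∈ P, z i = σ i) ∧
      U.card ≤ k ∧ Certifies f z U ∧ ∀ j ∈ U, j ∉ P → z j ∉ A := by
  by_contra! hcon
  have hG : ∀ z ∈ completions P σ, Function.Bijective z ∧ ∀ i ∈ P, z i = σ i :=
    fun z hz => (Finset.mem_filter.1 hz).2
  have hG0 : 0 < (completions P σ).card :=
    Finset.card_pos.2 ⟨σ, Finset.mem_filter.2 ⟨Finset.mem_univ _, hσ, fun _ _ => rfl⟩⟩
  have hupper : ∑ z ∈ completions P σ, expCost B z ≤ (completions P σ).card * r := by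
    rw [← nsmul_eq_mul]
    exact Finset.sum_le_card_nsmul _ _ _ fun z hz => hr z (hG z hz).1
  have hlower : ((k : ℝ) + 1) * ((completions P σ).card / 2) ≤
      ∑ z ∈ completions P σ, expCost B z := by
    refine le_sum_expCost B _ _ fun j hj => ?_
    have hsub : hits P A σ k (B.tree j) ⊆ completions P σ := Finset.filter_subset _ _
    have hcost : ∀ z ∈ completions P σ \ hits P A σ k (B.tree j),
        ((k : ℝ) + 1) ≤ ((B.tree j).cost z : ℝ) := by
      intro z hz
      obtain ⟨hzG, hzh⟩ := Finset.mem_sdiff.1 hz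
      by_contra! hlt
      rw [← Nat.cast_add_one, Nat.cast_lt, Nat.lt_succ_iff] at hlt
      obtain ⟨q, hq, hqP, hqA⟩ := hcon z ((B.tree j).path z).toFinset (hG z hzG).1 (hG z hzG).2
        ((List.toFinset_card_le _).trans (((B.tree j).length_path z).le.trans hlt))
        ((hB j hj).certifies (hG z hzG).1)
      exact hzh (Finset.mem_filter.2 ⟨hzG, hlt, q, List.mem_toFinset.1 hq, hqP, hqA⟩)
    have hhalf : 2 * (hits P A σ k (B.tree j)).card ≤ (completions P σ).card := by
      refine Nat.le_of_mul_le_mul_right ?_ hpos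
      calc 2 * (hits P A σ k (B.tree j)).card * (n - P.card - k)
          = 2 * ((hits P A σ k (B.tree j)).card * (n - P.card - k)) := by ring
        _ ≤ 2 * ((completions P σ).card * (A.card * k)) :=
            Nat.mul_le_mul_left 2 (card_hits_mul_le P A σ k (B.tree j))
        _ = (completions P σ).card * (2 * (A.card * k)) := by ring
        _ ≤ (completions P σ).card * (n - P.card - k) := Nat.mul_le_mul_left _ hlarge
    have hdiff : ((completions P σ).card : ℝ) / 2 ≤
        ((completions P σ \ hits P A σ k (B.tree j)).card : ℝ) := by
      rw [Finset.card_sdiff_of_subset hsub, Nat.cast_sub (Finset.card_le_card hsub)]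
      have : (2 : ℝ) * ((hits P A σ k (B.tree j)).card : ℝ) ≤ (completions P σ).card := by
        exact_mod_cast hhalf
      linarith
    calc ((k : ℝ) + 1) * ((completions P σ).card / 2)
        ≤ (k + 1) * ((completions P σ \ hits P A σ k (B.tree j)).card : ℝ) := by gcongr
      _ = (completions P σ \ hits P A σ k (B.tree j)).card • ((k : ℝ) + 1) := by
          rw [nsmul_eq_mul, mul_comm]
      _ ≤ ∑ z ∈ completions P σ \ hits P A σ k (B.tree j), ((B.tree j).cost z : ℝ) :=
          Finset.card_nsmul_le_sum _ _ _ hcost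
      _ ≤ ∑ z ∈ completions P σ, ((B.tree j).cost z : ℝ) :=
          Finset.sum_le_sum_of_subset_of_nonneg Finset.sdiff_subset
            fun _ _ _ => Nat.cast_nonneg _
  have hG0' : (0 : ℝ) < (completions P σ).card := by exact_mod_cast hG0
  nlinarith

theorem exists_tree_depth_le {n : ℕ} (f : (Fin n → Fin n) → Bool) (X : Set (Fin n → Fin n)) :
    ∃ t : DTree n n, t.depth ≤ n ∧ Computes X f t := by
  have hleaf : ∀ x ∈ X, ∃ t : DTree n n, t.depth ≤ 0 ∧
      Computes {y ∈ X | ∀ i ∈ Finset.univ, y i = x i} f t := by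
    refine fun x _ => ⟨.leaf (f x), le_rfl, fun y hy => ?_⟩
    rw [show y = x from funext fun i => hy.2 i (Finset.mem_univ i), DTree.eval]
  obtain ⟨t, ht, hc⟩ := exists_tree_of_query f 0 Finset.univ X hleaf
  exact ⟨t, by simpa using ht, hc⟩

theorem detD_le {n M : ℕ} {X : Set (Fin n → Fin M)} {f : (Fin n → Fin M) → Bool}
    {t : DTree n M} {d : ℕ} (ht : t.depth ≤ d) (hc : Computes X f t) : detD X f ≤ d := by
  refine le_trans (Nat.sInf_le ?_) ht
  exact ⟨t, hc, rfl⟩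

theorem detD_le_of_expCost_le {n : ℕ} {f : (Fin n → Fin n) → Bool} (B : RandAlg n n)
    (hB : ZeroError {x : Fin n → Fin n | Function.Bijective x} f B) {k : ℕ} {r : ℝ}
    (hr : ∀ y, Function.Bijective y → expCost B y ≤ r) (hk : 2 * r < k + 1)
    (hn : 1 ≤ n) (hkn : 26 * k ^ 3 ≤ n) :
    detD {x : Fin n → Fin n | Function.Bijective x} f ≤ 5 * k ^ 2 := by
  have hr0 : 0 ≤ r := (expCost_nonneg B id).trans (hr id Function.bijective_id)
  have hk3 : 4 * k * k + k + 8 * k ^ 3 ≤ n ∧ 4 * k * k + k < n := by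
    rcases Nat.eq_zero_or_pos k with rfl | hkpos
    · simpa using Nat.pos_of_ne_zero (Nat.one_le_iff_ne_zero.1 hn)
    · have h1 : k * k ≤ k ^ 3 := by nlinarith [Nat.mul_le_mul_left (k * k) hkpos]
      have h2 : k ≤ k * k := Nat.le_mul_self k
      constructor <;> nlinarith
  obtain ⟨t, ht, hc⟩ := exists_tree_of_rounds f k
    (fun y hy => exists_certificate B hB hy (by linarith [hr y hy]))
    (fun P A σ hσ hP hA => exists_fresh_certificate B hB hr hk P A hσ (by omega) (by
      have : A.card * k ≤ 4 * k * k * k := Nat.mul_le_mul_right k hA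
      have : 4 * k * k * k = 4 * k ^ 3 := by ring
      omega))
    (4 * k + 1) ∅ ∅ id (fun _ => 0) Function.bijective_id (by simp) (by simp) (by simp)
    (fun _ _ _ _ _ => by simp)
  refine detD_le (ht.trans ?_) fun y hy => hc y ⟨hy, by simp⟩
  nlinarith [Nat.le_mul_self k]

/-- on the promise of permutations (`M = n`, all bijections
`Fin n → Fin n`), `R₀(f) ≥ c · min(D(f)^{1/2}, n^{1/3})`, and consequently
`R₀(f) ≥ c · D(f)^{1/3}`. -/
theorem R0_lower_bound_permutations : ∃ c : ℝ, 0 < c ∧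
    ∀ n : ℕ, 1 ≤ n →
    ∀ f : (Fin n → Fin n) → Bool,
      c * min ((detD {x : Fin n → Fin n | Function.Bijective x} f : ℝ) ^ ((1 : ℝ) / 2))
          ((n : ℝ) ^ ((1 : ℝ) / 3)) ≤
        R0 {x : Fin n → Fin n | Function.Bijective x} f ∧
      c * (detD {x : Fin n → Fin n | Function.Bijective x} f : ℝ) ^ ((1 : ℝ) / 3) ≤
        R0 {x : Fin n → Fin n | Function.Bijective x} f := by
  refine ⟨1 / 6, by norm_num, fun n hn f => ?_⟩
  set X : Set (Fin n → Fin n) := {x | Function.Bijective x}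
  have hmain : 1 / 6 * min ((detD X f : ℝ) ^ ((1 : ℝ) / 2)) ((n : ℝ) ^ ((1 : ℝ) / 3)) ≤
      R0 X f := by
    obtain ⟨t₀, -, hc₀⟩ := exists_tree_depth_le f X
    refine le_csInf ⟨_, ⟨1, fun _ => t₀, fun _ => 1, by simp, by simp⟩, fun _ _ => hc₀, rfl⟩ ?_
    rintro r ⟨B, hB, rfl⟩
    have hr : ∀ y, Function.Bijective y → expCost B y ≤ algCost X B :=
      fun y hy => expCost_le_algCost B hy
    set r := algCost X B
    have hr0 : 0 ≤ r := (expCost_nonneg B id).trans (hr id Function.bijective_id)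
    set k := ⌊2 * r⌋₊
    have hkr : (k : ℝ) ≤ 2 * r := Nat.floor_le (by positivity)
    by_cases hkn : 26 * k ^ 3 ≤ n
    · have hD : (detD X f : ℝ) ≤ 5 * (k : ℝ) ^ 2 := by
        exact_mod_cast detD_le_of_expCost_le B hB hr (Nat.lt_floor_add_one _) hn hkn
      have hsq : (detD X f : ℝ) ^ ((1 : ℝ) / 2) ≤ 6 * r := by
        rw [← Real.sqrt_eq_rpow]
        refine Real.sqrt_le_iff.2 ⟨by positivity, ?_⟩
        nlinarith [(Nat.cast_nonneg k : (0 : ℝ) ≤ k)]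
      linarith [min_le_left ((detD X f : ℝ) ^ ((1 : ℝ) / 2)) ((n : ℝ) ^ ((1 : ℝ) / 3))]
    · have hnk : (n : ℝ) ≤ 26 * (k : ℝ) ^ 3 := by exact_mod_cast (not_le.1 hkn).le
      have hcube : (n : ℝ) ≤ (6 * r) ^ 3 := by
        have : (k : ℝ) ^ 3 ≤ (2 * r) ^ 3 := pow_le_pow_left₀ (Nat.cast_nonneg k) hkr 3
        have : 0 ≤ r ^ 3 := by positivity
        nlinarith
      have hroot : (n : ℝ) ^ ((1 : ℝ) / 3) ≤ 6 * r := by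
        calc (n : ℝ) ^ ((1 : ℝ) / 3) ≤ ((6 * r) ^ 3) ^ ((1 : ℝ) / 3) := by gcongr
          _ = 6 * r := by
            rw [← Real.rpow_natCast, ← Real.rpow_mul (by positivity)]
            norm_num
      linarith [min_le_right ((detD X f : ℝ) ^ ((1 : ℝ) / 2)) ((n : ℝ) ^ ((1 : ℝ) / 3))]
  refine ⟨hmain, le_trans (mul_le_mul_of_nonneg_left ?_ (by norm_num)) hmain⟩
  refine le_min ?_ ?_
  · rcases Nat.eq_zero_or_pos (detD X f) with h0 | hpos
    · rw [h0]
      norm_num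
    · exact Real.rpow_le_rpow_of_exponent_le (by exact_mod_cast hpos) (by norm_num)
  · obtain ⟨t, ht, hc⟩ := exists_tree_depth_le f X
    have : (detD X f : ℝ) ≤ n := by exact_mod_cast detD_le ht hc
    gcongr

end QCPaper
end
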